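/- Let φ(R) = ∀x̄ (Rx̄ → θ(R, x̄)) be a myopic sentence, where R is an n-ary relation symbol. Then there exists an Inclusion Logic formula φ⁺(x̄) with free variables x̄ = (x₁,…,xₙ) such that for all structures M and all teams X over M with domain {x₁,…,xₙ}: M ⊨_X φ⁺(x̄) if and only if (M, X(x̄)) ⊨ φ(R). -/

import Mathlib

open FirstOrder Language Set

namespace TeamSem

/-- The set of variables occurring in a term. -/
def tvars {L : Language} : L.Term ℕ → Set ℕ
  | Term.var v => {v}
  | Term.func _ ts => ⋃ i, tvars (ts i)

/-- Formulas of Inclusion Logic FO(⊆) in negation normal form, over the signature `L`,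
with variables from `ℕ`. -/
inductive IncForm (L : Language) where
  | rel {n : ℕ} (R : L.Relations n) (ts : Fin n → L.Term ℕ)
  | nrel {n : ℕ} (R : L.Relations n) (ts : Fin n → L.Term ℕ)
  | eq (t u : L.Term ℕ)
  | neq (t u : L.Term ℕ)
  | incl {k : ℕ} (ts us : Fin k → L.Term ℕ)
  | and (φ ψ : IncForm L)
  | or (φ ψ : IncForm L)
  | ex (v : ℕ) (φ : IncForm L)
  | all (v : ℕ) (φ : IncForm L)

variable {L : Language}

/-- The supplemented team `X[H/v]`. -/
def suppTeam {M : Type*} (X : Set (ℕ → M)) (H : (ℕ → M) → Set M) (v : ℕ) : Set (ℕ → M) :=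
  {t | ∃ s ∈ X, ∃ m ∈ H s, t = Function.update s v m}

/-- The duplicated team `X[M/v]`. -/
def dupTeam (M : Type*) (X : Set (ℕ → M)) (v : ℕ) : Set (ℕ → M) :=
  {t | ∃ s ∈ X, ∃ m : M, t = Function.update s v m}

/-- Lax team semantics for Inclusion Logic: `teamSat M φ X` says `M ⊨_X φ`. -/
def teamSat (M : Type*) [L.Structure M] : IncForm L → Set (ℕ → M) → Prop
  | .rel R ts, X => ∀ s ∈ X, Structure.RelMap R fun i => (ts i).realize s
  | .nrel R ts, X => ∀ s ∈ X, ¬ Structure.RelMap R fun i => (ts i).realize s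
  | .eq t u, X => ∀ s ∈ X, t.realize s = u.realize s
  | .neq t u, X => ∀ s ∈ X, t.realize s ≠ u.realize s
  | .incl ts us, X => ∀ s ∈ X, ∃ s' ∈ X, ∀ i, (ts i).realize s = (us i).realize s'
  | .and φ ψ, X => teamSat M φ X ∧ teamSat M ψ X
  | .or φ ψ, X => ∃ Y Z, X = Y ∪ Z ∧ teamSat M φ Y ∧ teamSat M ψ Z
  | .ex v φ, X => ∃ H : (ℕ → M) → Set M, (∀ s ∈ X, (H s).Nonempty) ∧
      teamSat M φ (suppTeam X H v)
  | .all v φ, X => teamSat M φ (dupTeam M X v)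

/-- Free variables of an Inclusion Logic formula. -/
def fvInc : IncForm L → Set ℕ
  | .rel _ ts => ⋃ i, tvars (ts i)
  | .nrel _ ts => ⋃ i, tvars (ts i)
  | .eq t u => tvars t ∪ tvars u
  | .neq t u => tvars t ∪ tvars u
  | .incl ts us => (⋃ i, tvars (ts i)) ∪ ⋃ i, tvars (us i)
  | .and φ ψ => fvInc φ ∪ fvInc ψ
  | .or φ ψ => fvInc φ ∪ fvInc ψ
  | .ex v φ => fvInc φ \ {v}
  | .all v φ => fvInc φ \ {v}

/-- Truth of an FO(⊆) sentence in a model: satisfaction by the team consisting of the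
empty assignment (encoded, with total assignments, as the singleton team `{s}` for
every `s`; for sentences all these coincide). -/
def incTrue (M : Type*) [L.Structure M] (φ : IncForm L) : Prop :=
  ∀ s : ℕ → M, teamSat M φ {s}

/-- The relation `X(x̄)` of values of a team, for `x̄ = (x_0, …, x_{n-1})` where we use
the variables `0, …, n-1` for `x₁, …, xₙ`. -/
def teamRel (n : ℕ) {M : Type*} (X : Set (ℕ → M)) : Set (Fin n → M) :=
  {a | ∃ s ∈ X, a = fun j : Fin n => s (j : ℕ)}

end TeamSem

namespace TeamSem

/-- Interpretations of second-order relation variables: relation variable number `i`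
of arity `k` is interpreted as `I k i`. -/
def RelInterp (M : Type*) : Type _ := (k : ℕ) → ℕ → Set (Fin k → M)

/-- The trivial interpretation (all relation variables empty). -/
def botI (M : Type*) : RelInterp M := fun _ _ => ∅

/-- Update the interpretation of relation variable `i` of arity `n` to `Q`. -/
def updI {M : Type*} (I : RelInterp M) (n i : ℕ) (Q : Set (Fin n → M)) : RelInterp M :=
  fun k j => {a | if h : k = n ∧ j = i then (fun m => a (Fin.cast h.1.symm m)) ∈ Q else a ∈ I k j}

/-- Simultaneous update of an assignment on the variables `xs` by the tuple `a`. -/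
noncomputable def updVec {M : Type*} (s : ℕ → M) {n : ℕ} (xs : Fin n → ℕ)
    (a : Fin n → M) : ℕ → M :=
  fun v => if h : ∃ j, xs j = v then a h.choose else s v

/-- Formulas of Positive Greatest Fixed Point Logic (PGFP) in negation normal form:
second-order relation variables (`rvar i`, of arity `n`) and the `gfp` operator can occur
only positively (there are no negated `rvar`/`gfp` constructors). -/
inductive GFPForm (L : Language) where
  | rel {n : ℕ} (R : L.Relations n) (ts : Fin n → L.Term ℕ)
  | nrel {n : ℕ} (R : L.Relations n) (ts : Fin n → L.Term ℕ)
  | eq (t u : L.Term ℕ)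
  | neq (t u : L.Term ℕ)
  | rvar (i : ℕ) {n : ℕ} (ts : Fin n → L.Term ℕ)
  | and (φ ψ : GFPForm L)
  | or (φ ψ : GFPForm L)
  | ex (v : ℕ) (φ : GFPForm L)
  | all (v : ℕ) (φ : GFPForm L)
  | gfp (i n : ℕ) (xs : Fin n → ℕ) (φ : GFPForm L) (ts : Fin n → L.Term ℕ)

variable {L : Language}

/-- Tarski semantics for PGFP.  The clause for `gfp i n xs φ ts` uses the Knaster–Tarski
characterization: the greatest fixed point of the monotone operator
`Γ(Q) = {ā | (M, Q/i) ⊨ φ(ā)}` equals `⋃ {Q | Q ⊆ Γ(Q)}`. -/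
def gsat (M : Type*) [L.Structure M] : GFPForm L → RelInterp M → (ℕ → M) → Prop
  | .rel R ts, _, s => Structure.RelMap R fun i => (ts i).realize s
  | .nrel R ts, _, s => ¬ Structure.RelMap R fun i => (ts i).realize s
  | .eq t u, _, s => t.realize s = u.realize s
  | .neq t u, _, s => t.realize s ≠ u.realize s
  | .rvar i ts, I, s => (fun j => (ts j).realize s) ∈ I _ i
  | .and φ ψ, I, s => gsat M φ I s ∧ gsat M ψ I s
  | .or φ ψ, I, s => gsat M φ I s ∨ gsat M ψ I s
  | .ex v φ, I, s => ∃ m : M, gsat M φ I (Function.update s v m)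
  | .all v φ, I, s => ∀ m : M, gsat M φ I (Function.update s v m)
  | .gfp i n xs φ ts, I, s =>
      (fun j => (ts j).realize s) ∈
        ⋃₀ {Q : Set (Fin n → M) | Q ⊆ {a | gsat M φ (updI I n i Q) (updVec s xs a)}}

/-- Free first-order variables of a PGFP formula. -/
def fvG : GFPForm L → Set ℕ
  | .rel _ ts => ⋃ i, tvars (ts i)
  | .nrel _ ts => ⋃ i, tvars (ts i)
  | .eq t u => tvars t ∪ tvars u
  | .neq t u => tvars t ∪ tvars u
  | .rvar _ ts => ⋃ i, tvars (ts i)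
  | .and φ ψ => fvG φ ∪ fvG ψ
  | .or φ ψ => fvG φ ∪ fvG ψ
  | .ex v φ => fvG φ \ {v}
  | .all v φ => fvG φ \ {v}
  | .gfp _ _ xs φ ts => (⋃ i, tvars (ts i)) ∪ (fvG φ \ Set.range fun j => xs j)

/-- All first-order variables (free or bound) occurring in a PGFP formula. -/
def avG : GFPForm L → Set ℕ
  | .rel _ ts => ⋃ i, tvars (ts i)
  | .nrel _ ts => ⋃ i, tvars (ts i)
  | .eq t u => tvars t ∪ tvars u
  | .neq t u => tvars t ∪ tvars u
  | .rvar _ ts => ⋃ i, tvars (ts i)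
  | .and φ ψ => avG φ ∪ avG ψ
  | .or φ ψ => avG φ ∪ avG ψ
  | .ex v φ => {v} ∪ avG φ
  | .all v φ => {v} ∪ avG φ
  | .gfp _ _ xs φ ts => (⋃ i, tvars (ts i)) ∪ (Set.range fun j => xs j) ∪ avG φ

/-- Free relation variables of a PGFP formula, together with their arities. -/
def rvG : GFPForm L → Set (ℕ × ℕ)
  | @GFPForm.rvar _ i n _ => {(i, n)}
  | .and φ ψ => rvG φ ∪ rvG ψ
  | .or φ ψ => rvG φ ∪ rvG ψ
  | .ex _ φ => rvG φ
  | .all _ φ => rvG φ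
  | .gfp i n _ φ _ => rvG φ \ {(i, n)}
  | _ => ∅

/-- PGFP formulas containing no `gfp` operator, i.e. first-order formulas
(possibly mentioning relation variables positively). -/
def NoGfp : GFPForm L → Prop
  | .and φ ψ => NoGfp φ ∧ NoGfp ψ
  | .or φ ψ => NoGfp φ ∧ NoGfp ψ
  | .ex _ φ => NoGfp φ
  | .all _ φ => NoGfp φ
  | .gfp .. => False
  | _ => True

end TeamSem

namespace TeamSem

variable {L : Language}

theorem tvars_finite (t : L.Term ℕ) : (tvars t).Finite := by
  induction t with
  | var v => exact Set.finite_singleton v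
  | func f ts ih => exact Set.finite_iUnion ih

theorem avG_finite (φ : GFPForm L) : (avG φ).Finite := by
  induction φ with
  | rel R ts => exact Set.finite_iUnion fun i => tvars_finite _
  | nrel R ts => exact Set.finite_iUnion fun i => tvars_finite _
  | eq t u => exact (tvars_finite t).union (tvars_finite u)
  | neq t u => exact (tvars_finite t).union (tvars_finite u)
  | rvar i ts => exact Set.finite_iUnion fun i => tvars_finite _
  | and φ ψ ih₁ ih₂ => exact ih₁.union ih₂
  | or φ ψ ih₁ ih₂ => exact ih₁.union ih₂
  | ex v φ ih => exact (Set.finite_singleton v).union ih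
  | all v φ ih => exact (Set.finite_singleton v).union ih
  | gfp i n xs φ ts ih =>
    exact ((Set.finite_iUnion fun i => tvars_finite _).union (Set.finite_range _)).union ih

/-- The variables occurring in a formula are bounded by some `N ≥ n`. -/
theorem exists_fresh_bound (n : ℕ) (φ : GFPForm L) : ∃ N, n ≤ N ∧ ∀ v ∈ avG φ, v < N := by
  obtain ⟨B, hB⟩ := (avG_finite φ).bddAbove
  exact ⟨max n (B + 1), le_max_left _ _, fun v hv =>
    lt_of_lt_of_le (Nat.lt_succ_of_le (hB hv)) (le_max_right _ _)⟩

theorem fvG_subset_avG (φ : GFPForm L) : fvG φ ⊆ avG φ := by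
  induction φ with
  | rel R ts => exact subset_rfl
  | nrel R ts => exact subset_rfl
  | eq t u => exact subset_rfl
  | neq t u => exact subset_rfl
  | rvar i ts => exact subset_rfl
  | and φ ψ ih₁ ih₂ => exact Set.union_subset_union ih₁ ih₂
  | or φ ψ ih₁ ih₂ => exact Set.union_subset_union ih₁ ih₂
  | ex v φ ih => exact fun w hw => Or.inr (ih hw.1)
  | all v φ ih => exact fun w hw => Or.inr (ih hw.1)
  | gfp i n xs φ ts ih =>
    rintro w (hw | hw)
    · exact Or.inl (Or.inl hw)
    · exact Or.inr (ih hw.1)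

theorem realize_congr {M : Type*} [L.Structure M] (t : L.Term ℕ) {s s' : ℕ → M}
    (h : ∀ v ∈ tvars t, s v = s' v) : t.realize s = t.realize s' := by
  induction t with
  | var v => exact h v rfl
  | func f ts ih =>
    simp only [Term.realize_func]
    congr 1
    funext i
    exact ih i fun v hv => h v (Set.mem_iUnion.2 ⟨i, hv⟩)

theorem realize_tuple_congr {M : Type*} [L.Structure M] {k : ℕ} (ts : Fin k → L.Term ℕ)
    {s s' : ℕ → M} (h : ∀ v ∈ ⋃ i, tvars (ts i), s v = s' v) :
    (fun i => (ts i).realize s) = fun i => (ts i).realize s' :=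
  funext fun i => realize_congr _ fun v hv => h v (Set.mem_iUnion.2 ⟨i, hv⟩)

theorem update_eqOn_of_diff {M : Type*} {A : Set ℕ} {v : ℕ} {s s' : ℕ → M}
    (h : ∀ w ∈ A \ {v}, s w = s' w) (m : M) :
    ∀ w ∈ A, Function.update s v m w = Function.update s' v m w := by
  intro w hw
  by_cases hv : w = v
  · subst hv; simp
  · simpa [hv] using h w ⟨hw, hv⟩

/-- The truth of a first-order formula depends only on the values of its free variables. -/
theorem gsat_congr {M : Type*} [L.Structure M] (φ : GFPForm L) (hφ : NoGfp φ)
    (I : RelInterp M) {s s' : ℕ → M} (h : ∀ v ∈ fvG φ, s v = s' v) :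
    gsat M φ I s ↔ gsat M φ I s' := by
  induction φ generalizing s s' with
  | rel R ts => simp only [gsat, realize_tuple_congr ts h]
  | nrel R ts => simp only [gsat, realize_tuple_congr ts h]
  | eq t u =>
    simp only [gsat, realize_congr t fun v hv => h v (Or.inl hv),
      realize_congr u fun v hv => h v (Or.inr hv)]
  | neq t u =>
    simp only [gsat, realize_congr t fun v hv => h v (Or.inl hv),
      realize_congr u fun v hv => h v (Or.inr hv)]
  | rvar i ts => simp only [gsat, realize_tuple_congr ts h]
  | and φ ψ ih₁ ih₂ =>
    exact and_congr (ih₁ hφ.1 fun v hv => h v (Or.inl hv))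
      (ih₂ hφ.2 fun v hv => h v (Or.inr hv))
  | or φ ψ ih₁ ih₂ =>
    exact or_congr (ih₁ hφ.1 fun v hv => h v (Or.inl hv))
      (ih₂ hφ.2 fun v hv => h v (Or.inr hv))
  | ex v φ ih => exact exists_congr fun m => ih hφ (update_eqOn_of_diff h m)
  | all v φ ih => exact forall_congr' fun m => ih hφ (update_eqOn_of_diff h m)
  | gfp => exact hφ.elim

theorem mem_updI_self {M : Type*} (I : RelInterp M) (n i : ℕ) (Q : Set (Fin n → M))
    (a : Fin n → M) : a ∈ updI I n i Q n i ↔ a ∈ Q := by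
  simp [updI]

/-- Replace each atom `R t̄` by the inclusion atom `t̄ ⊆ z̄`, where `z̄` is the tuple of variables
starting at `N`. The value on `gfp` formulas is irrelevant. -/
def inclTranslate (N : ℕ) : GFPForm L → IncForm L
  | .rel R ts => .rel R ts
  | .nrel R ts => .nrel R ts
  | .eq t u => .eq t u
  | .neq t u => .neq t u
  | @GFPForm.rvar _ _ _ ts => .incl ts fun j => Term.var (N + j)
  | .and φ ψ => .and (inclTranslate N φ) (inclTranslate N ψ)
  | .or φ ψ => .or (inclTranslate N φ) (inclTranslate N ψ)
  | .ex v φ => .ex v (inclTranslate N φ)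
  | .all v φ => .all v (inclTranslate N φ)
  | .gfp _ _ _ _ ts => .incl ts ts

theorem fvInc_inclTranslate {n N : ℕ} (φ : GFPForm L) (hφ : NoGfp φ)
    (hrv : rvG φ ⊆ {(0, n)}) :
    fvInc (inclTranslate N φ) ⊆ fvG φ ∪ {v | N ≤ v ∧ v < N + n} := by
  induction φ with
  | rel R ts => exact Set.subset_union_left
  | nrel R ts => exact Set.subset_union_left
  | eq t u => exact Set.subset_union_left
  | neq t u => exact Set.subset_union_left
  | @rvar i k ts =>
    have hk : (i, k) = (0, n) := hrv rfl
    obtain ⟨rfl, rfl⟩ := Prod.mk.inj hk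
    refine Set.union_subset_union subset_rfl (Set.iUnion_subset fun j => ?_)
    rintro v (rfl : v = N + j)
    exact ⟨Nat.le_add_right _ _, Nat.add_lt_add_left j.2 _⟩
  | and φ ψ ih₁ ih₂ =>
    have h₁ := ih₁ hφ.1 (Set.subset_union_left.trans hrv)
    have h₂ := ih₂ hφ.2 (Set.subset_union_right.trans hrv)
    rintro v (hv | hv)
    · exact (h₁ hv).imp_left Or.inl
    · exact (h₂ hv).imp_left Or.inr
  | or φ ψ ih₁ ih₂ =>
    have h₁ := ih₁ hφ.1 (Set.subset_union_left.trans hrv)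
    have h₂ := ih₂ hφ.2 (Set.subset_union_right.trans hrv)
    rintro v (hv | hv)
    · exact (h₁ hv).imp_left Or.inl
    · exact (h₂ hv).imp_left Or.inr
  | ex v φ ih => exact fun w hw => (ih hφ hrv hw.1).imp_left fun h => ⟨h, hw.2⟩
  | all v φ ih => exact fun w hw => (ih hφ hrv hw.1).imp_left fun h => ⟨h, hw.2⟩
  | gfp => exact hφ.elim

/-- If the values of `z̄` in the team all lie in `Q`, the translation implies the formula with `R`
interpreted as `Q`. -/
theorem gsat_of_teamSat_inclTranslate {M : Type*} [L.Structure M] {n N : ℕ}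
    (Q : Set (Fin n → M)) (φ : GFPForm L) (hφ : NoGfp φ) (hrv : rvG φ ⊆ {(0, n)})
    (hN : ∀ v ∈ avG φ, v < N) (Y : Set (ℕ → M))
    (hY : ∀ s ∈ Y, (fun j : Fin n => s (N + j)) ∈ Q)
    (hsat : teamSat M (inclTranslate N φ) Y) :
    ∀ s ∈ Y, gsat M φ (updI (botI M) n 0 Q) s := by
  induction φ generalizing Y with
  | rel R ts => exact hsat
  | nrel R ts => exact hsat
  | eq t u => exact hsat
  | neq t u => exact hsat
  | @rvar i k ts =>
    have hk : (i, k) = (0, n) := hrv rfl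
    obtain ⟨rfl, rfl⟩ := Prod.mk.inj hk
    intro s hs
    obtain ⟨s', hs', h⟩ := hsat s hs
    refine (mem_updI_self _ _ _ _ _).2 ?_
    have hts : (fun j => (ts j).realize s) = fun j : Fin k => s' (N + j) := funext h
    exact hts ▸ hY s' hs'
  | and φ ψ ih₁ ih₂ =>
    exact fun s hs =>
      ⟨ih₁ hφ.1 (Set.subset_union_left.trans hrv) (fun v hv => hN v (Or.inl hv)) Y hY hsat.1 s hs,
        ih₂ hφ.2 (Set.subset_union_right.trans hrv) (fun v hv => hN v (Or.inr hv)) Y hY hsat.2 s hs⟩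
  | or φ ψ ih₁ ih₂ =>
    obtain ⟨Y₁, Y₂, rfl, h₁, h₂⟩ := hsat
    rintro s (hs | hs)
    · exact Or.inl (ih₁ hφ.1 (Set.subset_union_left.trans hrv) (fun v hv => hN v (Or.inl hv)) Y₁
        (fun s hs => hY s (Or.inl hs)) h₁ s hs)
    · exact Or.inr (ih₂ hφ.2 (Set.subset_union_right.trans hrv) (fun v hv => hN v (Or.inr hv)) Y₂
        (fun s hs => hY s (Or.inr hs)) h₂ s hs)
  | ex v φ ih =>
    obtain ⟨H, hne, h⟩ := hsat
    have hv : v < N := hN v (Or.inl rfl)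
    have key := ih hφ hrv (fun w hw => hN w (Or.inr hw)) _ (by
      rintro _ ⟨s, hs, m, -, rfl⟩
      convert hY s hs using 2 with j
      exact Function.update_of_ne (by omega) _ _) h
    intro s hs
    obtain ⟨m, hm⟩ := hne s hs
    exact ⟨m, key _ ⟨s, hs, m, hm, rfl⟩⟩
  | all v φ ih =>
    have hv : v < N := hN v (Or.inl rfl)
    have key := ih hφ hrv (fun w hw => hN w (Or.inr hw)) _ (by
      rintro _ ⟨s, hs, m, rfl⟩
      convert hY s hs using 2 with j
      exact Function.update_of_ne (by omega) _ _) hsat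
    exact fun s hs m => key _ ⟨s, hs, m, rfl⟩
  | gfp => exact hφ.elim

/-- Replace the values of the block of variables `N, …, N + n - 1` by the tuple `a`. -/
def updBlock {M : Type*} (N : ℕ) {n : ℕ} (s : ℕ → M) (a : Fin n → M) : ℕ → M :=
  fun v => if h : N ≤ v ∧ v < N + n then a ⟨v - N, by omega⟩ else s v

theorem updBlock_apply_add {M : Type*} (N : ℕ) {n : ℕ} (s : ℕ → M) (a : Fin n → M) (j : Fin n) :
    updBlock N s a (N + j) = a j := by
  simp [updBlock]

theorem updBlock_of_not_mem {M : Type*} {N n : ℕ} (s : ℕ → M) (a : Fin n → M) {v : ℕ}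
    (h : ¬ (N ≤ v ∧ v < N + n)) : updBlock N s a v = s v :=
  dif_neg h

theorem updBlock_updBlock {M : Type*} (N : ℕ) {n : ℕ} (s : ℕ → M) (a b : Fin n → M) :
    updBlock N (updBlock N s a) b = updBlock N s b := by
  funext v
  by_cases h : N ≤ v ∧ v < N + n <;> simp [updBlock, h]

theorem updBlock_update {M : Type*} {N n : ℕ} (s : ℕ → M) (a : Fin n → M) {v : ℕ} (hv : v < N)
    (m : M) : updBlock N (Function.update s v m) a = Function.update (updBlock N s a) v m := by
  funext w
  by_cases hw : w = v
  · subst hw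
    rw [updBlock_of_not_mem _ _ (by omega)]
    simp
  · simp [updBlock, hw]

theorem gsat_updBlock {M : Type*} [L.Structure M] {n N : ℕ} (φ : GFPForm L) (hφ : NoGfp φ)
    (hN : ∀ v ∈ avG φ, v < N) (I : RelInterp M) (s : ℕ → M) (a : Fin n → M) :
    gsat M φ I (updBlock N s a) ↔ gsat M φ I s :=
  gsat_congr φ hφ I fun v hv => updBlock_of_not_mem s a <| by
    have := hN v (fvG_subset_avG φ hv)
    omega

/-- On a team in which `z̄` ranges freely over `Q`, the translation follows from the formula with
`R` interpreted as `Q`. -/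
theorem teamSat_inclTranslate_of_gsat {M : Type*} [L.Structure M] {n N : ℕ}
    (Q : Set (Fin n → M)) (φ : GFPForm L) (hφ : NoGfp φ) (hrv : rvG φ ⊆ {(0, n)})
    (hN : ∀ v ∈ avG φ, v < N) (Y : Set (ℕ → M))
    (hY : ∀ s ∈ Y, ∀ a ∈ Q, updBlock N s a ∈ Y)
    (hsat : ∀ s ∈ Y, gsat M φ (updI (botI M) n 0 Q) s) :
    teamSat M (inclTranslate N φ) Y := by
  induction φ generalizing Y with
  | rel R ts => exact hsat
  | nrel R ts => exact hsat
  | eq t u => exact hsat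
  | neq t u => exact hsat
  | @rvar i k ts =>
    have hk : (i, k) = (0, n) := hrv rfl
    obtain ⟨rfl, rfl⟩ := Prod.mk.inj hk
    intro s hs
    exact ⟨_, hY s hs _ ((mem_updI_self _ _ _ _ _).1 (hsat s hs)),
      fun j => (updBlock_apply_add N s (fun j => (ts j).realize s) j).symm⟩
  | and φ ψ ih₁ ih₂ =>
    exact ⟨ih₁ hφ.1 (Set.subset_union_left.trans hrv) (fun v hv => hN v (Or.inl hv)) Y hY
        fun s hs => (hsat s hs).1,
      ih₂ hφ.2 (Set.subset_union_right.trans hrv) (fun v hv => hN v (Or.inr hv)) Y hY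
        fun s hs => (hsat s hs).2⟩
  | or φ ψ ih₁ ih₂ =>
    have hN₁ : ∀ v ∈ avG φ, v < N := fun v hv => hN v (Or.inl hv)
    have hN₂ : ∀ v ∈ avG ψ, v < N := fun v hv => hN v (Or.inr hv)
    refine ⟨{s ∈ Y | gsat M φ (updI (botI M) n 0 Q) s}, {s ∈ Y | gsat M ψ (updI (botI M) n 0 Q) s},
      ?_, ih₁ hφ.1 (Set.subset_union_left.trans hrv) hN₁ _ ?_ fun s hs => hs.2,
      ih₂ hφ.2 (Set.subset_union_right.trans hrv) hN₂ _ ?_ fun s hs => hs.2⟩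
    · ext s
      exact ⟨fun hs => (hsat s hs).imp (⟨hs, ·⟩) (⟨hs, ·⟩), fun h => h.elim (·.1) (·.1)⟩
    · exact fun s hs a ha => ⟨hY s hs.1 a ha, (gsat_updBlock φ hφ.1 hN₁ _ s a).2 hs.2⟩
    · exact fun s hs a ha => ⟨hY s hs.1 a ha, (gsat_updBlock ψ hφ.2 hN₂ _ s a).2 hs.2⟩
  | ex v φ ih =>
    have hv : v < N := hN v (Or.inl rfl)
    have hN' : ∀ w ∈ avG φ, w < N := fun w hw => hN w (Or.inr hw)
    refine ⟨fun s => {m | gsat M φ (updI (botI M) n 0 Q) (Function.update s v m)}, hsat,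
      ih hφ hrv hN' _ ?_ ?_⟩
    · rintro _ ⟨s, hs, m, hm, rfl⟩ a ha
      refine ⟨updBlock N s a, hY s hs a ha, m, ?_, updBlock_update s a hv m⟩
      rw [Set.mem_ofPred_eq, ← updBlock_update s a hv m]
      exact (gsat_updBlock φ hφ hN' _ _ a).2 hm
    · rintro _ ⟨s, hs, m, hm, rfl⟩
      exact hm
  | all v φ ih =>
    have hv : v < N := hN v (Or.inl rfl)
    refine ih hφ hrv (fun w hw => hN w (Or.inr hw)) _ ?_ ?_
    · rintro _ ⟨s, hs, m, rfl⟩ a ha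
      exact ⟨updBlock N s a, hY s hs a ha, m, updBlock_update s a hv m⟩
    · rintro _ ⟨s, hs, m, rfl⟩
      exact hsat s hs m
  | gfp => exact hφ.elim

/-- Existentially quantify the block of variables `N, …, N + k - 1`. -/
def exBlock (N : ℕ) : ℕ → IncForm L → IncForm L
  | 0, φ => φ
  | k + 1, φ => .ex (N + k) (exBlock N k φ)

theorem fvInc_exBlock (N k : ℕ) (φ : IncForm L) :
    fvInc (exBlock N k φ) ⊆ fvInc φ \ {v | N ≤ v ∧ v < N + k} := by
  induction k with
  | zero => exact fun v hv => ⟨hv, fun h => by simp at h; omega⟩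
  | succ k ih =>
    rintro v ⟨hv, hne⟩
    refine ⟨(ih hv).1, fun h => (ih hv).2 ⟨h.1, ?_⟩⟩
    have h₂ : v < N + (k + 1) := h.2
    have h₃ : v ≠ N + k := hne
    omega

/-- Two assignments agree outside of the block of variables `N, …, N + k - 1`. -/
def AgreeOff {M : Type*} (N k : ℕ) (s s' : ℕ → M) : Prop :=
  ∀ v, ¬ (N ≤ v ∧ v < N + k) → s v = s' v

theorem AgreeOff.update_left {M : Type*} {N k : ℕ} {s s' : ℕ → M} (h : AgreeOff N (k + 1) s s') :
    AgreeOff N k (Function.update s (N + k) (s' (N + k))) s' := by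
  intro v hv
  by_cases hvk : v = N + k
  · subst hvk; simp
  · rw [Function.update_of_ne hvk]
    exact h v (by omega)

theorem AgreeOff.of_update_left {M : Type*} {N k : ℕ} {s s' : ℕ → M} {m : M}
    (h : AgreeOff N k (Function.update s (N + k) m) s') : AgreeOff N (k + 1) s s' := by
  intro v hv
  have := h v (by omega)
  rwa [Function.update_of_ne (by omega)] at this

/-- A team satisfies a block of existential quantifiers iff some team which has the same
assignments up to the values on the block satisfies the matrix. -/
theorem teamSat_exBlock {M : Type*} [L.Structure M] (N k : ℕ) (φ : IncForm L)
    (X : Set (ℕ → M)) :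
    teamSat M (exBlock N k φ) X ↔ ∃ Y : Set (ℕ → M), (∀ s ∈ X, ∃ s' ∈ Y, AgreeOff N k s s') ∧
      (∀ s' ∈ Y, ∃ s ∈ X, AgreeOff N k s s') ∧ teamSat M φ Y := by
  induction k generalizing X with
  | zero =>
    have hag : ∀ s s' : ℕ → M, AgreeOff N 0 s s' → s = s' := fun s s' h =>
      funext fun v => h v (by omega)
    constructor
    · exact fun h => ⟨X, fun s hs => ⟨s, hs, fun _ _ => rfl⟩, fun s hs => ⟨s, hs, fun _ _ => rfl⟩, h⟩
    · rintro ⟨Y, h₁, h₂, h⟩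
      have hXY : X = Y := by
        ext s
        constructor
        · intro hs
          obtain ⟨s', hs', e⟩ := h₁ s hs
          exact hag s s' e ▸ hs'
        · intro hs
          obtain ⟨s', hs', e⟩ := h₂ s hs
          exact hag s' s e ▸ hs'
      exact hXY ▸ h
  | succ k ih =>
    constructor
    · rintro ⟨H, hne, h⟩
      obtain ⟨Y, h₁, h₂, hY⟩ := (ih _).1 h
      refine ⟨Y, fun s hs => ?_, fun s' hs' => ?_, hY⟩
      · obtain ⟨m, hm⟩ := hne s hs
        obtain ⟨s', hs', hag⟩ := h₁ _ ⟨s, hs, m, hm, rfl⟩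
        exact ⟨s', hs', hag.of_update_left⟩
      · obtain ⟨_, ⟨s, hs, m, -, rfl⟩, hag⟩ := h₂ s' hs'
        exact ⟨s, hs, hag.of_update_left⟩
    · rintro ⟨Y, h₁, h₂, hY⟩
      refine ⟨fun s => {m | ∃ s' ∈ Y, AgreeOff N (k + 1) s s' ∧ s' (N + k) = m}, ?_,
        (ih _).2 ⟨Y, ?_, ?_, hY⟩⟩
      · intro s hs
        obtain ⟨s', hs', hag⟩ := h₁ s hs
        exact ⟨_, s', hs', hag, rfl⟩
      · rintro _ ⟨s, hs, _, ⟨s', hs', hag, rfl⟩, rfl⟩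
        exact ⟨s', hs', hag.update_left⟩
      · intro s' hs'
        obtain ⟨s, hs, hag⟩ := h₂ s' hs'
        exact ⟨_, ⟨s, hs, _, ⟨s', hs', hag, rfl⟩, rfl⟩, hag.update_left⟩

end TeamSem

open TeamSem in
/-- let `φ(R) = ∀x̄ (Rx̄ → θ(R, x̄))` be a myopic sentence, i.e. `θ` is a
first-order formula (no `gfp` operators) in which the `n`-ary relation symbol `R` occurs
only positively (here `R` is relation variable number `0` of arity `n`, and relation
variables occur only positively in the syntax `GFPForm`), with free variables among
`x̄ = (x₁,…,xₙ)` (here the variables `0,…,n-1`). Then there is an inclusion logic formula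
`φ⁺(x̄)` such that for all structures `M` and teams `X` with domain `{x₁,…,xₙ}`:
`M ⊨_X φ⁺(x̄)` iff `(M, X(x̄)) ⊨ ∀x̄ (Rx̄ → θ(R, x̄))`. -/
theorem myopic_definable_in_inc {L : Language} (n : ℕ) (θ : GFPForm L) (hfo : NoGfp θ)
    (hrv : rvG θ ⊆ {(0, n)}) (hfv : fvG θ ⊆ {v : ℕ | v < n}) :
    ∃ φplus : IncForm L, fvInc φplus ⊆ {v : ℕ | v < n} ∧
      ∀ (M : Type*) [L.Structure M] (X : Set (ℕ → M)),
        teamSat M φplus X ↔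
          ∀ s : ℕ → M, (fun j : Fin n => s (j : ℕ)) ∈ teamRel n X →
            gsat M θ (updI (botI M) n 0 (teamRel n X)) s := by
  obtain ⟨N, hnN, hN⟩ := exists_fresh_bound n θ
  refine ⟨exBlock N n (.and (.incl (fun j : Fin n => Term.var (N + j))
    fun j : Fin n => Term.var (j : ℕ)) (inclTranslate N θ)), ?_, ?_⟩
  · intro v hv
    obtain ⟨hv, hvN⟩ := fvInc_exBlock _ _ _ hv
    rcases hv with (hv | hv) | hv
    · obtain ⟨j, rfl : v = N + j⟩ := Set.mem_iUnion.1 hv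
      exact absurd ⟨Nat.le_add_right _ _, Nat.add_lt_add_left j.2 _⟩ hvN
    · obtain ⟨j, rfl : v = j⟩ := Set.mem_iUnion.1 hv
      exact j.2
    · exact (fvInc_inclTranslate θ hfo hrv hv).elim (fun h => hfv h) fun h => absurd h hvN
  intro M _ X
  rw [teamSat_exBlock]
  constructor
  · rintro ⟨Y, h₁, h₂, hincl, hsat⟩ s ⟨s₀, hs₀, hs⟩
    have hYQ : ∀ t ∈ Y, (fun j : Fin n => t (N + j)) ∈ teamRel n X := by
      intro t ht
      obtain ⟨t', ht', e⟩ := hincl t ht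
      obtain ⟨u, hu, hag⟩ := h₂ t' ht'
      refine ⟨u, hu, funext fun j => (e j).trans (hag j ?_).symm⟩
      have := j.2
      omega
    obtain ⟨s', hs', hag⟩ := h₁ s₀ hs₀
    refine (gsat_congr θ hfo _ fun v hv => ?_).2
      (gsat_of_teamSat_inclTranslate (teamRel n X) θ hfo hrv hN Y hYQ hsat s' hs')
    have hvn : v < n := hfv hv
    exact (congrFun hs ⟨v, hvn⟩).trans (hag v (by omega))
  · intro h
    have hmem : ∀ s ∈ X, (fun j : Fin n => s (j : ℕ)) ∈ teamRel n X := fun s hs => ⟨s, hs, rfl⟩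
    refine ⟨{t | ∃ s ∈ X, ∃ a ∈ teamRel n X, t = updBlock N s a}, ?_, ?_, ?_,
      teamSat_inclTranslate_of_gsat (teamRel n X) θ hfo hrv hN _ ?_ ?_⟩
    · exact fun s hs => ⟨_, ⟨s, hs, _, hmem s hs, rfl⟩,
        fun v hv => (updBlock_of_not_mem _ _ hv).symm⟩
    · rintro _ ⟨s, hs, a, -, rfl⟩
      exact ⟨s, hs, fun v hv => (updBlock_of_not_mem _ _ hv).symm⟩
    · rintro _ ⟨s, hs, a, ⟨u, hu, rfl⟩, rfl⟩
      refine ⟨_, ⟨u, hu, _, hmem u hu, rfl⟩, fun j => ?_⟩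
      have := j.2
      exact (updBlock_apply_add N s _ j).trans (updBlock_of_not_mem u _ (by omega)).symm
    · rintro _ ⟨s, hs, a, -, rfl⟩ b hb
      exact ⟨s, hs, b, hb, updBlock_updBlock N s a b⟩
    · rintro _ ⟨s, hs, a, -, rfl⟩
      exact (gsat_updBlock θ hfo hN _ s a).2 (h s (hmem s hs))
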